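/- arXiv:2401.05456 — 2 statements merged into one kernel-verified Lean document; each statement's English description precedes it below -/
import Mathlib

section
/- Let A_1,…,A_n be complex square matrices and 0 < p ≤ 2. Then n^(p-1)·∑_{i=1}^n ‖A_i‖_p^p ≤ ‖∑_{i=1}^n A_i‖_p^p + ∑_{1≤i<j≤n} ‖A_i − A_j‖_p^p. -/
open scoped ComplexOrder

/-- The Schatten `p`-(quasi)norm of a square complex matrix:
`‖X‖_p = (tr |X|^p)^(1/p)`, computed as `(∑ i, λ_i(Xᴴ * X) ^ (p/2)) ^ (1/p)`,
where `λ_i(Xᴴ * X)` are the (nonnegative) eigenvalues of `Xᴴ * X`, whose square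
roots are the singular values of `X`. -/
noncomputable def schattenNorm {m : Type*} [Fintype m] [DecidableEq m]
    (p : ℝ) (X : Matrix m m ℂ) : ℝ :=
  (∑ i, ((Matrix.posSemidef_conjTranspose_mul_self X).1.eigenvalues i ^ (p / 2))) ^ (1 / p)

open scoped Matrix

namespace Matrix

variable {m n : Type*} [Fintype m] [DecidableEq m] [Fintype n] [DecidableEq n] {q : ℝ}

/-- The sum of the `q`-th powers of the real parts of the roots of the characteristic polynomial;
for a positive semidefinite matrix `M` this is `tr (M ^ q)`. -/
noncomputable def powerTrace (q : ℝ) (M : Matrix m m ℂ) : ℝ :=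
  (M.charpoly.roots.map fun z => z.re ^ q).sum

lemma IsHermitian.powerTrace_eq {M : Matrix m m ℂ} (hM : M.IsHermitian) :
    powerTrace q M = ∑ i, hM.eigenvalues i ^ q := by
  simp [powerTrace, hM.roots_charpoly_eq_eigenvalues]

lemma powerTrace_mul_comm (hq : q ≠ 0) (A : Matrix m n ℂ) (B : Matrix n m ℂ) :
    powerTrace q (A * B) = powerTrace q (B * A) := by
  have h := congrArg (fun P => (P.roots.map fun z : ℂ => z.re ^ q).sum) (charpoly_mul_comm' A B)
  have key (k : ℕ) {P : Polynomial ℂ} (hP : P.Monic) :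
      ((Polynomial.X ^ k * P).roots.map fun z : ℂ => z.re ^ q).sum =
        (P.roots.map fun z : ℂ => z.re ^ q).sum := by
    rw [Polynomial.roots_mul ((Polynomial.monic_X_pow k).mul hP).ne_zero]
    simp [Multiset.nsmul_singleton, Real.zero_rpow hq]
  simpa only [powerTrace, key _ (charpoly_monic _)] using h

lemma IsHermitian.exists_unitary_diagonal {M : Matrix m m ℂ} (hM : M.IsHermitian) :
    ∃ U : Matrix m m ℂ, Uᴴ * U = 1 ∧ U * Uᴴ = 1 ∧
      M = U * diagonal (fun i => (hM.eigenvalues i : ℂ)) * Uᴴ := by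
  refine ⟨hM.eigenvectorUnitary, ?_, ?_, ?_⟩
  · exact Unitary.coe_star_mul_self hM.eigenvectorUnitary
  · exact Unitary.coe_mul_star_self hM.eigenvectorUnitary
  · conv_lhs => rw [hM.spectral_theorem, Unitary.conjStarAlgAut_apply]
    rfl

lemma powerTrace_conjTranspose_mul_mul (hq : q ≠ 0) {U : Matrix m m ℂ} (hU : U * Uᴴ = 1)
    (M : Matrix m m ℂ) : powerTrace q (Uᴴ * M * U) = powerTrace q M := by
  rw [powerTrace_mul_comm hq, ← Matrix.mul_assoc, hU, Matrix.one_mul]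

lemma sum_normSq_row_eq_one {U : Matrix m m ℂ} (hU : U * Uᴴ = 1) (i : m) :
    ∑ j, Complex.normSq (U i j) = 1 := by
  have h := congrFun (congrFun hU i) i
  simp only [mul_apply, conjTranspose_apply, one_apply_eq, Complex.star_def,
    Complex.mul_conj] at h
  exact_mod_cast h

lemma PosSemidef.re_diag_nonneg {ι : Type*} {M : Matrix ι ι ℂ} (hM : M.PosSemidef) (i : ι) :
    0 ≤ (M i i).re :=
  (Complex.le_def.1 (hM.diag_nonneg (i := i))).1

lemma PosSemidef.powerTrace_le_sum_diag (hq₀ : 0 ≤ q) (hq₁ : q ≤ 1) {M : Matrix m m ℂ}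
    (hM : M.PosSemidef) : powerTrace q M ≤ ∑ i, (M i i).re ^ q := by
  obtain ⟨U, hU, hU', hMU⟩ := hM.1.exists_unitary_diagonal
  have hdiag (i : m) : (M i i).re = ∑ j, Complex.normSq (U i j) * hM.1.eigenvalues j := by
    have h : M i i = ∑ j, ((Complex.normSq (U i j) * hM.1.eigenvalues j : ℝ) : ℂ) := by
      conv_lhs => rw [hMU]
      simp only [mul_apply (M := U * _), mul_diagonal, conjTranspose_apply, Complex.star_def]
      refine Finset.sum_congr rfl fun j _ => ?_
      rw [mul_right_comm, Complex.mul_conj, Complex.ofReal_mul]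
    rw [h, ← Complex.ofReal_sum, Complex.ofReal_re]
  have hcol (j : m) : ∑ i, Complex.normSq (U i j) = 1 := by
    simpa [Complex.normSq_conj] using
      sum_normSq_row_eq_one (U := Uᴴ) (by rwa [conjTranspose_conjTranspose]) j
  calc powerTrace q M = ∑ j, ∑ i, Complex.normSq (U i j) * hM.1.eigenvalues j ^ q := by
        simp_rw [hM.1.powerTrace_eq, ← Finset.sum_mul, hcol, one_mul]
    _ = ∑ i, ∑ j, Complex.normSq (U i j) * hM.1.eigenvalues j ^ q := Finset.sum_comm
    _ ≤ ∑ i, (M i i).re ^ q := Finset.sum_le_sum fun i _ => by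
        rw [hdiag]
        exact (Real.concaveOn_rpow hq₀ hq₁).le_map_sum (fun j _ => Complex.normSq_nonneg _)
          (sum_normSq_row_eq_one hU' i) fun j _ => hM.eigenvalues_nonneg j

lemma PosSemidef.exists_conjTranspose_mul_self_eq {M : Matrix m m ℂ} (hM : M.PosSemidef) :
    ∃ C : Matrix m m ℂ, Cᴴ * C = M ∧
      C * Cᴴ = diagonal (fun i => (hM.1.eigenvalues i : ℂ)) := by
  obtain ⟨U, hU, -, hMU⟩ := hM.1.exists_unitary_diagonal
  set D : Matrix m m ℂ := diagonal fun i => ((√(hM.1.eigenvalues i) : ℝ) : ℂ)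
  have hD : Dᴴ = D := by simp [D, diagonal_conjTranspose, Pi.star_def]
  have hDD : D * D = diagonal (fun i => (hM.1.eigenvalues i : ℂ)) := by
    simp only [D, diagonal_mul_diagonal, ← Complex.ofReal_mul,
      Real.mul_self_sqrt (hM.eigenvalues_nonneg _)]
  refine ⟨D * Uᴴ, ?_, ?_⟩
  · conv_rhs => rw [hMU]
    simp only [conjTranspose_mul, conjTranspose_conjTranspose, hD, ← hDD, Matrix.mul_assoc]
  · rw [conjTranspose_mul, conjTranspose_conjTranspose, hD, ← hDD, Matrix.mul_assoc,
      ← Matrix.mul_assoc Uᴴ, hU, Matrix.one_mul]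

lemma powerTrace_add_le (hq₀ : 0 < q) (hq₁ : q ≤ 1) {P Q : Matrix m m ℂ}
    (hP : P.PosSemidef) (hQ : Q.PosSemidef) :
    powerTrace q (P + Q) ≤ powerTrace q P + powerTrace q Q := by
  obtain ⟨B, hB, hB'⟩ := hP.exists_conjTranspose_mul_self_eq
  obtain ⟨C, hC, hC'⟩ := hQ.exists_conjTranspose_mul_self_eq
  have h : P + Q = (fromRows B C)ᴴ * fromRows B C := by
    rw [conjTranspose_fromRows_eq_fromCols_conjTranspose, fromCols_mul_fromRows, hB, hC]
  rw [h, powerTrace_mul_comm hq₀.ne']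
  refine ((posSemidef_self_mul_conjTranspose _).powerTrace_le_sum_diag hq₀.le hq₁).trans_eq ?_
  rw [conjTranspose_fromRows_eq_fromCols_conjTranspose, fromRows_mul_fromCols, hB', hC',
    Fintype.sum_sum_type, hP.1.powerTrace_eq, hQ.1.powerTrace_eq]
  simp

lemma powerTrace_sum_le {ι : Type*} (hq₀ : 0 < q) (hq₁ : q ≤ 1) (s : Finset ι)
    {P : ι → Matrix m m ℂ} (hP : ∀ i ∈ s, (P i).PosSemidef) :
    powerTrace q (∑ i ∈ s, P i) ≤ ∑ i ∈ s, powerTrace q (P i) :=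
  Finset.le_sum_of_subadditive_on_pred (powerTrace q) PosSemidef
    (by simp [powerTrace, Real.zero_rpow hq₀.ne', Multiset.nsmul_singleton])
    (fun _ _ => powerTrace_add_le hq₀ hq₁) (fun _ _ => PosSemidef.add) P hP

/-- Jensen's inequality for `t ↦ t ^ q`, cleared of the weights `1 / card ι`. -/
lemma _root_.Real.card_rpow_mul_sum_rpow_le {ι : Type*} [Fintype ι] (hq₀ : 0 ≤ q) (hq₁ : q ≤ 1)
    {x : ι → ℝ} (hx : ∀ i, 0 ≤ x i) :
    (Fintype.card ι : ℝ) ^ (q - 1) * ∑ i, x i ^ q ≤ (∑ i, x i) ^ q := by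
  rcases isEmpty_or_nonempty ι with h | h
  · simpa using Real.zero_rpow_nonneg q
  have hc : (0 : ℝ) < Fintype.card ι := by exact_mod_cast Fintype.card_pos
  have h := (Real.concaveOn_rpow hq₀ hq₁).le_map_sum (t := Finset.univ)
    (w := fun _ : ι => (Fintype.card ι : ℝ)⁻¹) (p := x) (fun _ _ => by positivity)
    (by simp [hc.ne']) (fun i _ => hx i)
  simp only [smul_eq_mul, ← Finset.mul_sum] at h
  rw [Real.mul_rpow (by positivity) (Finset.sum_nonneg fun i _ => hx i),
    Real.inv_rpow hc.le, ← div_eq_inv_mul _ ((_ : ℝ) ^ q), le_div_iff₀ (by positivity)] at h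
  rw [Real.rpow_sub_one hc.ne']
  exact (by ring : _ = _).trans_le h

lemma card_rpow_mul_sum_powerTrace_le {ι : Type*} [Fintype ι] (hq₀ : 0 < q) (hq₁ : q ≤ 1)
    {P : ι → Matrix m m ℂ} (hP : ∀ i, (P i).PosSemidef) :
    (Fintype.card ι : ℝ) ^ (q - 1) * ∑ i, powerTrace q (P i) ≤ powerTrace q (∑ i, P i) := by
  have hS : (∑ i, P i).PosSemidef := posSemidef_sum _ fun i _ => hP i
  obtain ⟨U, hU, hU', hSU⟩ := hS.1.exists_unitary_diagonal
  have hdiag : ∑ i, Uᴴ * P i * U = diagonal (fun k => (hS.1.eigenvalues k : ℂ)) := by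
    rw [← Finset.sum_mul, ← Finset.mul_sum]
    conv_lhs => rw [hSU]
    rw [← Matrix.mul_assoc, ← Matrix.mul_assoc, hU, Matrix.one_mul, Matrix.mul_assoc, hU,
      Matrix.mul_one]
  have hR (i : ι) : (Uᴴ * P i * U).PosSemidef := (hP i).conjTranspose_mul_mul_same U
  have heig (k : m) : hS.1.eigenvalues k = ∑ i, ((Uᴴ * P i * U) k k).re := by
    have h := congrArg (fun M : Matrix m m ℂ => (M k k).re) hdiag
    simpa [sum_apply] using h.symm
  calc (Fintype.card ι : ℝ) ^ (q - 1) * ∑ i, powerTrace q (P i)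
      ≤ (Fintype.card ι : ℝ) ^ (q - 1) * ∑ i, ∑ k, ((Uᴴ * P i * U) k k).re ^ q := by
        gcongr with i
        rw [← powerTrace_conjTranspose_mul_mul hq₀.ne' hU' (P i)]
        exact (hR i).powerTrace_le_sum_diag hq₀.le hq₁
    _ = ∑ k, (Fintype.card ι : ℝ) ^ (q - 1) * ∑ i, ((Uᴴ * P i * U) k k).re ^ q := by
        rw [Finset.sum_comm, Finset.mul_sum]
    _ ≤ ∑ k, hS.1.eigenvalues k ^ q := Finset.sum_le_sum fun k _ => by
        rw [heig]
        exact Real.card_rpow_mul_sum_rpow_le hq₀.le hq₁ fun i => (hR i).re_diag_nonneg k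
    _ = powerTrace q (∑ i, P i) := hS.1.powerTrace_eq.symm

/-- The generalized parallelogram law for matrices. -/
lemma conjTranspose_mul_self_sum_add_sum_sub {k : ℕ} (A : Fin k → Matrix m m ℂ) :
    (∑ i, A i)ᴴ * (∑ i, A i) +
      ∑ i, ∑ j ∈ Finset.Ioi i, (A i - A j)ᴴ * (A i - A j) =
        ∑ x : Fin k × Fin k, (A x.1)ᴴ * A x.1 := by
  let f (j i : Fin k) : Matrix m m ℂ := (A i)ᴴ * (A i - A j)
  have h₁ (i j : Fin k) : (A i - A j)ᴴ * (A i - A j) = f j i + f i j := by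
    simp only [f, conjTranspose_sub]
    noncomm_ring
  have h₂ (i : Fin k) : ∑ j ∈ {i}ᶜ, f j i = ∑ j, f j i := by
    rw [Fintype.sum_eq_add_sum_compl i]
    simp [f]
  simp_rw [h₁]
  rw [Finset.sum_sum_Ioi_add_eq_sum_sum_off_diag]
  simp_rw [h₂, f, mul_sub, Finset.sum_sub_distrib, conjTranspose_sum, Finset.sum_mul,
    Finset.mul_sum, Fintype.sum_prod_type]
  abel

end Matrix

lemma schattenNorm_rpow {m : Type*} [Fintype m] [DecidableEq m] {p : ℝ} (hp : p ≠ 0)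
    (X : Matrix m m ℂ) :
    schattenNorm p X ^ p = Matrix.powerTrace (p / 2) (Xᴴ * X) := by
  have hX := Matrix.posSemidef_conjTranspose_mul_self X
  rw [schattenNorm, one_div, Real.rpow_inv_rpow _ hp, hX.1.powerTrace_eq]
  exact Finset.sum_nonneg fun i _ => Real.rpow_nonneg (hX.eigenvalues_nonneg i) _

theorem hirzallah_kittaneh_p_le_two {m : Type*} [Fintype m] [DecidableEq m] (n : ℕ)
    (A : Fin n → Matrix m m ℂ)
    (p : ℝ) (hp0 : 0 < p) (hp2 : p ≤ 2) :
    (n : ℝ) ^ (p - 1) * ∑ i, schattenNorm p (A i) ^ p ≤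
      schattenNorm p (∑ i, A i) ^ p +
        ∑ i, ∑ j ∈ Finset.Ioi i, schattenNorm p (A i - A j) ^ p := by
  have hq₀ : 0 < p / 2 := by positivity
  have hq₁ : p / 2 ≤ 1 := by linarith
  have hpos (X : Matrix m m ℂ) : (Xᴴ * X).PosSemidef := Matrix.posSemidef_conjTranspose_mul_self X
  simp_rw [schattenNorm_rpow hp0.ne']
  rcases n.eq_zero_or_pos with rfl | hn
  · simp [Matrix.powerTrace, Real.zero_rpow hq₀.ne', Multiset.nsmul_singleton]
  have hn' : (0 : ℝ) < n := by exact_mod_cast hn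
  calc (n : ℝ) ^ (p - 1) * ∑ i, Matrix.powerTrace (p / 2) ((A i)ᴴ * A i)
      = (Fintype.card (Fin n × Fin n) : ℝ) ^ (p / 2 - 1) *
          ∑ x : Fin n × Fin n, Matrix.powerTrace (p / 2) ((A x.1)ᴴ * A x.1) := by
        simp only [Fintype.card_prod, Fintype.card_fin, Nat.cast_mul, Fintype.sum_prod_type,
          Finset.sum_const, Finset.card_univ, nsmul_eq_mul, ← Finset.mul_sum]
        rw [← mul_assoc, Real.mul_rpow hn'.le hn'.le, ← Real.rpow_add hn',
          ← Real.rpow_add_one hn'.ne']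
        ring_nf
    _ ≤ Matrix.powerTrace (p / 2) (∑ x : Fin n × Fin n, (A x.1)ᴴ * A x.1) :=
        Matrix.card_rpow_mul_sum_powerTrace_le hq₀ hq₁ fun x => hpos (A x.1)
    _ = Matrix.powerTrace (p / 2) ((∑ i, A i)ᴴ * (∑ i, A i) +
          ∑ i, ∑ j ∈ Finset.Ioi i, (A i - A j)ᴴ * (A i - A j)) := by
        rw [Matrix.conjTranspose_mul_self_sum_add_sum_sub]
    _ ≤ _ := by
        have hpos' (i : Fin n) :
            (∑ j ∈ Finset.Ioi i, (A i - A j)ᴴ * (A i - A j)).PosSemidef :=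
          Matrix.posSemidef_sum _ fun j _ => hpos _
        refine (Matrix.powerTrace_add_le hq₀ hq₁ (hpos _)
          (Matrix.posSemidef_sum _ fun i _ => hpos' i)).trans ?_
        gcongr
        refine (Matrix.powerTrace_sum_le hq₀ hq₁ _ fun i _ => hpos' i).trans ?_
        gcongr
        exact Matrix.powerTrace_sum_le hq₀ hq₁ _ fun j _ => hpos _
end

section
/- (McCarthy) For complex square matrices A, B, 1 < p ≤ 2, and q with 1/p + 1/q = 1: ‖A+B‖_p^q + ‖A−B‖_p^q ≤ 2·(‖A‖_p^p + ‖B‖_p^p)^(q/p). -/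
open scoped ComplexOrder

section

open Matrix Complex

/-- A singular value decomposition `X = U * diag σ * Vᴴ` in which the columns of `U` belonging to
vanishing singular values are zero. -/
structure SingularDecomposition {m : Type*} [Fintype m] [DecidableEq m]
    (X : Matrix m m ℂ) where
  /-- left singular vectors -/
  U : Matrix m m ℂ
  /-- right singular vectors -/
  V : Matrix m m ℂ
  /-- singular values -/
  σ : m → ℝ
  σ_nonneg : ∀ i, 0 ≤ σ i
  V_unitary : Vᴴ * V = 1
  U_gram : Uᴴ * U = diagonal fun i => if σ i = 0 then 0 else 1
  eq_mul : X = U * diagonal (fun i => (σ i : ℂ)) * Vᴴ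
  schattenNorm_eq : ∀ p : ℝ, schattenNorm p X = (∑ i, σ i ^ p) ^ (1 / p)

variable {m : Type*} [Fintype m] [DecidableEq m]

theorem SingularDecomposition.exists (X : Matrix m m ℂ) : Nonempty (SingularDecomposition X) := by
  have hX := posSemidef_conjTranspose_mul_self X
  set lam := hX.1.eigenvalues with hlam
  have hlam0 : ∀ i, 0 ≤ lam i := hX.eigenvalues_nonneg
  set V : Matrix m m ℂ := (hX.1.eigenvectorUnitary : Matrix m m ℂ) with hV
  have hVV : Vᴴ * V = 1 := Unitary.coe_star_mul_self _
  have hVV' : V * Vᴴ = 1 := Unitary.coe_mul_star_self _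
  have hspec : Xᴴ * X = V * diagonal (fun i => (lam i : ℂ)) * Vᴴ := by
    have := hX.1.spectral_theorem
    rw [Unitary.conjStarAlgAut_apply] at this
    exact this
  have hgram : Vᴴ * Xᴴ * X * V = diagonal (fun i => (lam i : ℂ)) := by
    calc Vᴴ * Xᴴ * X * V = Vᴴ * (Xᴴ * X) * V := by simp only [Matrix.mul_assoc]
      _ = (Vᴴ * V) * diagonal (fun i => (lam i : ℂ)) * (Vᴴ * V) := by
        rw [hspec]; simp only [Matrix.mul_assoc]
      _ = _ := by rw [hVV]; simp
  have hconj (d : m → ℝ) : (X * V * diagonal (fun i => (d i : ℂ)))ᴴ *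
      (X * V * diagonal (fun i => (d i : ℂ))) = diagonal fun i => ((d i * lam i * d i : ℝ) : ℂ) := by
    calc _ = diagonal (fun i => (d i : ℂ)) * (Vᴴ * Xᴴ * X * V) * diagonal (fun i => (d i : ℂ)) := by
          have : (diagonal (fun i => (d i : ℂ)))ᴴ = diagonal (fun i => (d i : ℂ)) := by
            rw [diagonal_conjTranspose]; congr 1; ext i; simp
          simp only [conjTranspose_mul, this, Matrix.mul_assoc]
      _ = _ := by rw [hgram]; simp
  have hzero (i : m) : √(lam i) = 0 ↔ lam i = 0 := Real.sqrt_eq_zero (hlam0 i)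
  refine ⟨⟨X * V * diagonal (fun i => (((√(lam i))⁻¹ : ℝ) : ℂ)), V, fun i => √(lam i),
    fun i => Real.sqrt_nonneg _, hVV, ?_, ?_, ?_⟩⟩
  · rw [hconj]
    congr 1; ext i
    split_ifs with h
    · simp [h]
    · have h2 : (√(lam i))⁻¹ * lam i * (√(lam i))⁻¹ = 1 := by
        nth_rewrite 2 [← Real.mul_self_sqrt (hlam0 i)]
        field_simp
      rw [h2]; simp
  · have h0 : X * V * diagonal (fun i => ((if lam i = 0 then 1 else 0 : ℝ) : ℂ)) = 0 := by
      rw [← conjTranspose_mul_self_eq_zero, hconj]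
      ext i j
      by_cases hij : i = j
      · subst hij
        by_cases h : lam i = 0 <;> simp [h]
      · simp [hij]
    have h1 : X * V * diagonal (fun i => ((if lam i = 0 then 0 else 1 : ℝ) : ℂ)) = X * V := by
      have : diagonal (fun i => ((if lam i = 0 then 0 else 1 : ℝ) : ℂ)) =
          1 - diagonal (fun i => ((if lam i = 0 then 1 else 0 : ℝ) : ℂ)) := by
        rw [← diagonal_one, diagonal_sub]
        congr 1; ext i
        by_cases h : lam i = 0 <;> simp [h]
      rw [this, Matrix.mul_sub, h0]; simp
    have h2 : diagonal (fun i => (((√(lam i))⁻¹ : ℝ) : ℂ)) * diagonal (fun i => ((√(lam i) : ℝ) : ℂ))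
        = diagonal (fun i => ((if lam i = 0 then 0 else 1 : ℝ) : ℂ)) := by
      rw [diagonal_mul_diagonal]
      congr 1; ext i
      by_cases h : lam i = 0
      · simp [h]
      · have : √(lam i) ≠ 0 := fun h' => h ((hzero i).1 h')
        rw [← ofReal_mul, inv_mul_cancel₀ this]; simp [h]
    rw [Matrix.mul_assoc (X * V), h2, h1, Matrix.mul_assoc, hVV', Matrix.mul_one]
  · intro p
    unfold schattenNorm
    congr 1
    refine Finset.sum_congr rfl fun i _ => ?_
    rw [Real.sqrt_eq_rpow, ← Real.rpow_mul (hlam0 i)]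
    congr 1; ring

theorem schattenNorm_nonneg (p : ℝ) (X : Matrix m m ℂ) : 0 ≤ schattenNorm p X :=
  Real.rpow_nonneg (Finset.sum_nonneg fun i _ => Real.rpow_nonneg
    ((posSemidef_conjTranspose_mul_self X).eigenvalues_nonneg i) _) _

/-- The sum of the squared moduli of the entries of the `i`-th column. -/
noncomputable def colNormSq (X : Matrix m m ℂ) (i : m) : ℝ := ∑ j, ‖X j i‖ ^ 2

omit [DecidableEq m] in
theorem colNormSq_eq (X : Matrix m m ℂ) (i : m) : (colNormSq X i : ℂ) = (Xᴴ * X) i i := by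
  simp [colNormSq, Matrix.mul_apply, Complex.conj_mul']

/-- The square of the Hilbert–Schmidt norm. -/
noncomputable def frobSq (X : Matrix m m ℂ) : ℝ := ∑ i, colNormSq X i

omit [DecidableEq m] in
theorem frobSq_eq (X : Matrix m m ℂ) : (frobSq X : ℂ) = (Xᴴ * X).trace := by
  simp [frobSq, colNormSq_eq, Matrix.trace]

omit [DecidableEq m] in
theorem colNormSq_nonneg (X : Matrix m m ℂ) (i : m) : 0 ≤ colNormSq X i :=
  Finset.sum_nonneg fun _ _ => by positivity

omit [DecidableEq m] in
theorem frobSq_nonneg (X : Matrix m m ℂ) : 0 ≤ frobSq X :=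
  Finset.sum_nonneg fun _ _ => colNormSq_nonneg _ _

omit [DecidableEq m] in
theorem frobSq_conjTranspose (X : Matrix m m ℂ) : frobSq Xᴴ = frobSq X := by
  have : (frobSq Xᴴ : ℂ) = frobSq X := by
    rw [frobSq_eq, frobSq_eq, conjTranspose_conjTranspose, trace_mul_comm]
  exact_mod_cast this

omit [DecidableEq m] in
theorem frobSq_add_add_frobSq_sub (X Y : Matrix m m ℂ) :
    frobSq (X + Y) + frobSq (X - Y) = 2 * (frobSq X + frobSq Y) := by
  have : ((frobSq (X + Y) + frobSq (X - Y) : ℝ) : ℂ) = (2 * (frobSq X + frobSq Y) : ℝ) := by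
    push_cast
    simp only [frobSq_eq, conjTranspose_add, conjTranspose_sub, Matrix.add_mul, Matrix.sub_mul,
      Matrix.mul_add, Matrix.mul_sub, trace_add, trace_sub]
    ring
  exact_mod_cast this

omit [DecidableEq m] in
theorem norm_trace_mul_le (X Y : Matrix m m ℂ) :
    ‖(X * Y).trace‖ ≤ √(frobSq X) * √(frobSq Y) := by
  have h1 : frobSq X = ∑ x : m × m, ‖X x.1 x.2‖ ^ 2 := by
    rw [← frobSq_conjTranspose, Fintype.sum_prod_type]
    simp [frobSq, colNormSq]
  have h2 : frobSq Y = ∑ x : m × m, ‖Y x.2 x.1‖ ^ 2 := by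
    rw [Fintype.sum_prod_type]
    simp [frobSq, colNormSq]
  calc ‖(X * Y).trace‖ = ‖∑ x : m × m, X x.1 x.2 * Y x.2 x.1‖ := by
        rw [Fintype.sum_prod_type]; simp [Matrix.trace, Matrix.mul_apply]
    _ ≤ ∑ x : m × m, ‖X x.1 x.2‖ * ‖Y x.2 x.1‖ :=
        (norm_sum_le _ _).trans_eq (by simp)
    _ ≤ _ := by rw [h1, h2]; exact Real.sum_mul_le_sqrt_mul_sqrt _ _ _

theorem colNormSq_conjTranspose_mul_le {W : Matrix m m ℂ} (hW : W * Wᴴ * W = W)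
    (X : Matrix m m ℂ) (i : m) : colNormSq (Wᴴ * X) i ≤ colNormSq X i := by
  have h : (colNormSq X i : ℂ) = (colNormSq (Wᴴ * X) i + colNormSq ((1 - W * Wᴴ) * X) i : ℝ) := by
    push_cast
    rw [colNormSq_eq, colNormSq_eq, colNormSq_eq, ← Matrix.add_apply]
    have : (1 - W * Wᴴ) * (1 - W * Wᴴ) = 1 - W * Wᴴ := by
      rw [Matrix.sub_mul, Matrix.mul_sub, Matrix.mul_sub, ← Matrix.mul_assoc (W * Wᴴ), hW]
      simp
    refine congrFun₂ (?_ : (_ : Matrix m m ℂ) = _) i i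
    calc Xᴴ * X = Xᴴ * (W * Wᴴ) * X + Xᴴ * (1 - W * Wᴴ) * X := by
          rw [← Matrix.add_mul, ← Matrix.mul_add]; simp
      _ = _ := by
        conv_lhs => rw [← this]
        simp only [conjTranspose_mul, conjTranspose_conjTranspose, conjTranspose_sub,
          conjTranspose_one, Matrix.mul_assoc]
  have h' : colNormSq X i = colNormSq (Wᴴ * X) i + colNormSq ((1 - W * Wᴴ) * X) i := by
    exact_mod_cast h
  linarith [colNormSq_nonneg ((1 - W * Wᴴ) * X) i]

namespace SingularDecomposition

variable {X Y : Matrix m m ℂ} (s : SingularDecomposition X) (t : SingularDecomposition Y)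

theorem colNormSq_U_le (i : m) : colNormSq s.U i ≤ 1 := by
  have h : (colNormSq s.U i : ℂ) = ((if s.σ i = 0 then 0 else 1 : ℝ) : ℂ) := by
    rw [colNormSq_eq, s.U_gram, diagonal_apply_eq]; split_ifs <;> simp
  have h' : colNormSq s.U i = if s.σ i = 0 then 0 else 1 := by exact_mod_cast h
  rw [h']; split_ifs <;> norm_num

theorem colNormSq_V (i : m) : colNormSq s.V i = 1 := by
  have h : (colNormSq s.V i : ℂ) = 1 := by
    rw [colNormSq_eq, s.V_unitary]; simp
  exact_mod_cast h

theorem V_partialIsometry : s.V * s.Vᴴ * s.V = s.V := by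
  rw [Matrix.mul_assoc, s.V_unitary, Matrix.mul_one]

theorem U_partialIsometry : s.U * s.Uᴴ * s.U = s.U := by
  rw [← sub_eq_zero, ← conjTranspose_mul_self_eq_zero]
  have h : (s.Uᴴ * s.U) * (s.Uᴴ * s.U) = s.Uᴴ * s.U := by
    rw [s.U_gram, diagonal_mul_diagonal]
    congr 1; ext i; split_ifs <;> simp
  have h1 : s.U * s.Uᴴ * s.U - s.U = s.U * (s.Uᴴ * s.U - 1) := by
    rw [Matrix.mul_sub, Matrix.mul_one, Matrix.mul_assoc]
  have h2 : s.Uᴴ * s.U * (s.Uᴴ * s.U - 1) = 0 := by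
    rw [Matrix.mul_sub, h, Matrix.mul_one, sub_self]
  rw [h1, conjTranspose_mul, Matrix.mul_assoc, ← Matrix.mul_assoc s.Uᴴ, h2, Matrix.mul_zero]

/-- The matrix with the same singular vectors and the coefficients `α` as singular values. -/
noncomputable def deform (α : m → ℂ) : Matrix m m ℂ := s.U * diagonal α * s.Vᴴ

/-- The matrix with the roles of left and right singular vectors exchanged and the coefficients `γ`
as singular values. -/
noncomputable def codeform (γ : m → ℂ) : Matrix m m ℂ := s.V * diagonal γ * s.Uᴴ

theorem codeform_eq (γ : m → ℂ) : s.codeform γ = (s.deform (star γ))ᴴ := by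
  simp [codeform, deform, conjTranspose_mul, diagonal_conjTranspose, Matrix.mul_assoc]

theorem frobSq_deform_le (α : m → ℂ) : frobSq (s.deform α) ≤ ∑ i, ‖α i‖ ^ 2 := by
  have h : frobSq (s.deform α) = frobSq (s.U * diagonal α) := by
    have : (frobSq (s.deform α) : ℂ) = frobSq (s.U * diagonal α) := by
      rw [frobSq_eq, frobSq_eq, deform, conjTranspose_mul, Matrix.mul_assoc, trace_mul_comm]
      simp only [conjTranspose_conjTranspose, Matrix.mul_assoc, s.V_unitary, Matrix.mul_one]
    exact_mod_cast this
  rw [h]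
  refine Finset.sum_le_sum fun i _ => ?_
  have : colNormSq (s.U * diagonal α) i = colNormSq s.U i * ‖α i‖ ^ 2 := by
    simp [colNormSq, mul_pow, Finset.sum_mul]
  rw [this]
  exact mul_le_of_le_one_left (by positivity) (s.colNormSq_U_le i)

theorem frobSq_codeform_le (γ : m → ℂ) : frobSq (s.codeform γ) ≤ ∑ i, ‖γ i‖ ^ 2 := by
  rw [codeform_eq, frobSq_conjTranspose]
  simpa using s.frobSq_deform_le (star γ)

theorem trace_codeform_mul_deform (γ α : m → ℂ) : (t.codeform γ * s.deform α).trace =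
    ∑ i, ∑ j, γ j * α i * ((t.Uᴴ * s.U) j i * star ((t.Vᴴ * s.V) j i)) := by
  have : (t.codeform γ * s.deform α).trace =
      ((t.Vᴴ * s.V)ᴴ * (diagonal γ * ((t.Uᴴ * s.U) * diagonal α))).trace := by
    rw [codeform, deform, ← Matrix.mul_assoc, trace_mul_comm]
    simp only [conjTranspose_mul, conjTranspose_conjTranspose, Matrix.mul_assoc]
  rw [this, Matrix.trace]
  refine Finset.sum_congr rfl fun i _ => ?_
  rw [diag_apply, Matrix.mul_apply]
  refine Finset.sum_congr rfl fun j _ => ?_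
  rw [conjTranspose_apply, diagonal_mul, mul_diagonal]
  ring

theorem norm_trace_codeform_mul_deform_le {γ : m → ℂ} {c : ℝ} (hc : ∀ j, ‖γ j‖ ≤ c)
    (α : m → ℂ) : ‖(t.codeform γ * s.deform α).trace‖ ≤ c * ∑ i, ‖α i‖ := by
  rw [trace_codeform_mul_deform, Finset.mul_sum]
  refine norm_sum_le_of_le _ fun i _ => ?_
  have hc0 : 0 ≤ c := (norm_nonneg _).trans (hc i)
  have hP := (colNormSq_conjTranspose_mul_le t.U_partialIsometry s.U i).trans (s.colNormSq_U_le i)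
  have hQ := (colNormSq_conjTranspose_mul_le t.V_partialIsometry s.V i).trans_eq (s.colNormSq_V i)
  calc ‖∑ j, γ j * α i * ((t.Uᴴ * s.U) j i * star ((t.Vᴴ * s.V) j i))‖
      ≤ ∑ j, c * ‖α i‖ * (‖(t.Uᴴ * s.U) j i‖ * ‖(t.Vᴴ * s.V) j i‖) := by
        refine norm_sum_le_of_le _ fun j _ => ?_
        rw [norm_mul, norm_mul, norm_mul, norm_star]
        gcongr
        exact hc j
    _ = c * ‖α i‖ * ∑ j, ‖(t.Uᴴ * s.U) j i‖ * ‖(t.Vᴴ * s.V) j i‖ := by rw [Finset.mul_sum]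
    _ ≤ c * ‖α i‖ * 1 := by
        gcongr
        refine (Real.sum_mul_le_sqrt_mul_sqrt _ _ _).trans ?_
        exact mul_le_one₀ (Real.sqrt_le_one.2 hP) (Real.sqrt_nonneg _) (Real.sqrt_le_one.2 hQ)
    _ = c * ‖α i‖ := mul_one _

theorem trace_codeform_mul_self (γ : m → ℂ) :
    (s.codeform γ * X).trace = ∑ i, γ i * s.σ i := by
  have hX : s.codeform γ * X = s.codeform γ * s.deform (fun i => (s.σ i : ℂ)) :=
    congrArg (s.codeform γ * ·) s.eq_mul
  rw [hX, codeform, deform, ← Matrix.mul_assoc, trace_mul_comm]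
  have : s.Vᴴ * (s.V * diagonal γ * s.Uᴴ * (s.U * diagonal fun i => (s.σ i : ℂ))) =
      (s.Vᴴ * s.V) * diagonal γ * (s.Uᴴ * s.U) * diagonal fun i => (s.σ i : ℂ) := by
    simp only [Matrix.mul_assoc]
  rw [this, s.V_unitary, s.U_gram, Matrix.one_mul, diagonal_mul_diagonal, diagonal_mul_diagonal,
    trace_diagonal]
  refine Finset.sum_congr rfl fun i _ => ?_
  split_ifs with h <;> simp [h]

end SingularDecomposition

/-- The entire function `z ↦ s ^ (a + b * z)`, taken to be zero for `s = 0`. -/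
noncomputable def affinePow (s a b : ℝ) (z : ℂ) : ℂ :=
  if s = 0 then 0 else exp (Real.log s * (a + b * z))

theorem differentiable_affinePow (s a b : ℝ) : Differentiable ℂ (affinePow s a b) := by
  unfold affinePow
  split_ifs
  · exact differentiable_const 0
  · fun_prop

theorem norm_affinePow {s : ℝ} (hs : 0 < s) (a b : ℝ) (z : ℂ) :
    ‖affinePow s a b z‖ = s ^ (a + b * z.re) := by
  rw [affinePow, if_neg hs.ne', Complex.norm_exp, Real.rpow_def_of_pos hs]
  simp

theorem norm_affinePow_of_ne {s : ℝ} (hs : 0 ≤ s) {a b : ℝ} {z : ℂ} (h : a + b * z.re ≠ 0) :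
    ‖affinePow s a b z‖ = s ^ (a + b * z.re) := by
  rcases hs.eq_or_lt with rfl | hs
  · simp [affinePow, Real.zero_rpow h]
  · exact norm_affinePow hs a b z

theorem norm_affinePow_le (s a b : ℝ) {z : ℂ} (h0 : 0 ≤ z.re) (h1 : z.re ≤ 1) :
    ‖affinePow s a b z‖ ≤ Real.exp (|Real.log s| * (|a| + |b|)) := by
  unfold affinePow
  split_ifs
  · simpa using (Real.exp_pos _).le
  · rw [Complex.norm_exp, Real.exp_le_exp]
    have : ((Real.log s : ℂ) * (a + b * z)).re = Real.log s * (a + b * z.re) := by simp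
    rw [this]
    refine (le_abs_self _).trans ?_
    rw [abs_mul]
    gcongr
    refine (abs_add_le _ _).trans (add_le_add le_rfl ?_)
    rw [abs_mul, abs_of_nonneg h0]
    exact mul_le_of_le_one_right (abs_nonneg _) h1

theorem affinePow_ofReal {s : ℝ} (hs : 0 ≤ s) {a b x : ℝ} (h : a + b * x ≠ 0) :
    affinePow s a b x = (s ^ (a + b * x) : ℝ) := by
  rcases hs.eq_or_lt with rfl | hs
  · simp [affinePow, Real.zero_rpow h]
  · rw [affinePow, if_neg hs.ne', Real.rpow_def_of_pos hs]
    push_cast; rfl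

theorem exists_norm_affinePow_le {ι : Type*} [Finite ι] (s : ι → ℝ) (a b : ℝ) :
    ∃ K : ℝ, ∀ i, ∀ z : ℂ, 0 ≤ z.re → z.re ≤ 1 → ‖affinePow (s i) a b z‖ ≤ K := by
  obtain ⟨K, hK⟩ := (Set.finite_range fun i =>
    Real.exp (|Real.log (s i)| * (|a| + |b|))).bddAbove
  exact ⟨K, fun i z h0 h1 => (norm_affinePow_le _ _ _ h0 h1).trans (hK ⟨i, rfl⟩)⟩

namespace SingularDecomposition

variable {X Y : Matrix m m ℂ} (s : SingularDecomposition X)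
  (t : SingularDecomposition Y) {p q : ℝ}

theorem schattenNorm_rpow (hp : 0 < p) : schattenNorm p X ^ p = ∑ i, s.σ i ^ p := by
  rw [s.schattenNorm_eq, ← Real.rpow_mul
    (Finset.sum_nonneg fun i _ => Real.rpow_nonneg (s.σ_nonneg i) _), one_div,
    inv_mul_cancel₀ hp.ne', Real.rpow_one]

theorem schattenNorm_pos (p : ℝ) {i : m} (hi : s.σ i ≠ 0) : 0 < schattenNorm p X := by
  rw [s.schattenNorm_eq]
  refine Real.rpow_pos_of_pos (Finset.sum_pos' (fun i _ => Real.rpow_nonneg (s.σ_nonneg i) _)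
    ⟨i, Finset.mem_univ i, Real.rpow_pos_of_pos ((s.σ_nonneg i).lt_of_ne' hi) _⟩) _

/-- The interpolating family `σ i ^ (p * (1 - z / 2))` of singular values. -/
noncomputable def primal (p : ℝ) (z : ℂ) (i : m) : ℂ := affinePow (s.σ i) p (-(p / 2)) z

/-- The interpolating family of singular values of the matrix dual to `X`. -/
noncomputable def dual (p q : ℝ) (z : ℂ) (j : m) : ℂ :=
  affinePow (schattenNorm p X) q (-((q + p) / 2)) z * affinePow (s.σ j) 0 (p / 2) z

theorem sum_norm_primal (hp : 0 < p) {z : ℂ} (hz : z.re = 0) :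
    ∑ i, ‖s.primal p z i‖ = schattenNorm p X ^ p := by
  rw [s.schattenNorm_rpow hp]
  refine Finset.sum_congr rfl fun i _ => ?_
  have h : p + -(p / 2) * z.re = p := by rw [hz]; ring
  rw [primal, norm_affinePow_of_ne (s.σ_nonneg i) (by rw [h]; exact hp.ne'), h]

theorem sum_sq_norm_primal (hp : 0 < p) {z : ℂ} (hz : z.re = 1) :
    ∑ i, ‖s.primal p z i‖ ^ 2 = schattenNorm p X ^ p := by
  rw [s.schattenNorm_rpow hp]
  refine Finset.sum_congr rfl fun i _ => ?_
  have h : p + -(p / 2) * z.re = p / 2 := by rw [hz]; ring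
  rw [primal, norm_affinePow_of_ne (s.σ_nonneg i) (by rw [h]; positivity), h, ← Real.rpow_natCast,
    ← Real.rpow_mul (s.σ_nonneg i)]
  congr 1; push_cast; ring

theorem deform_primal (hp : 0 < p) (hpq : 1 / p + 1 / q = 1) :
    s.deform (s.primal p ((2 / q : ℝ) : ℂ)) = X := by
  have h : p + -(p / 2) * (2 / q) = 1 := by
    have : p + -(p / 2) * (2 / q) = p * (1 - 1 / q) := by ring
    rw [this, ← eq_sub_of_add_eq hpq, mul_one_div_cancel hp.ne']
  have h' : s.primal p ((2 / q : ℝ) : ℂ) = fun i => (s.σ i : ℂ) := by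
    ext i
    rw [primal, affinePow_ofReal (s.σ_nonneg i) (by rw [h]; exact one_ne_zero), h, Real.rpow_one]
  rw [h']
  exact s.eq_mul.symm

theorem norm_dual_le {z : ℂ} (hz : z.re = 0) (j : m) :
    ‖s.dual p q z j‖ ≤ schattenNorm p X ^ q := by
  by_cases hj : s.σ j = 0
  · have : s.dual p q z j = 0 := by simp [dual, affinePow, hj]
    rw [this, norm_zero]
    exact Real.rpow_nonneg (schattenNorm_nonneg p X) _
  · rw [dual, norm_mul, norm_affinePow (s.schattenNorm_pos p hj),
      norm_affinePow ((s.σ_nonneg j).lt_of_ne' hj), hz]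
    simp

theorem sum_sq_norm_dual_le (hp : 0 < p) {z : ℂ} (hz : z.re = 1) :
    ∑ j, ‖s.dual p q z j‖ ^ 2 ≤ schattenNorm p X ^ q := by
  rcases (schattenNorm_nonneg p X).eq_or_lt with h0 | h0
  · simp [dual, affinePow, ← h0, Real.rpow_nonneg]
  · have h (j : m) : ‖s.dual p q z j‖ ^ 2 = schattenNorm p X ^ (q - p) * s.σ j ^ p := by
      have h1 : 0 + p / 2 * z.re = p / 2 := by rw [hz]; ring
      rw [dual, norm_mul, norm_affinePow h0,
        norm_affinePow_of_ne (s.σ_nonneg j) (by rw [h1]; positivity), h1, mul_pow,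
        ← Real.rpow_natCast, ← Real.rpow_natCast, ← Real.rpow_mul h0.le,
        ← Real.rpow_mul (s.σ_nonneg j), hz]
      congr 2 <;> push_cast <;> ring
    simp_rw [h]
    rw [← Finset.mul_sum, ← s.schattenNorm_rpow hp, ← Real.rpow_add h0, sub_add_cancel]

theorem trace_codeform_dual (hp : 0 < p) (hq : 0 < q) (hpq : 1 / p + 1 / q = 1) :
    (s.codeform (s.dual p q ((2 / q : ℝ) : ℂ)) * X).trace = (schattenNorm p X ^ q : ℝ) := by
  rw [trace_codeform_mul_self]
  rcases (schattenNorm_nonneg p X).eq_or_lt with h0 | h0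
  · simp [dual, affinePow, ← h0, Real.zero_rpow hq.ne']
  · have hpq' : q + p = p * q := by field_simp at hpq; linarith
    have h1 : q + -((q + p) / 2) * (2 / q) = q - p := by rw [hpq']; field_simp; ring
    have h2 : 0 + p / 2 * (2 / q) = p - 1 := by field_simp; linarith
    have h3 : 0 < p - 1 := by rw [← h2]; positivity
    have h (j : m) : s.dual p q ((2 / q : ℝ) : ℂ) j * s.σ j =
        ((schattenNorm p X ^ (q - p) * s.σ j ^ p : ℝ) : ℂ) := by
      rw [dual]
      have h4 : affinePow (schattenNorm p X) q (-((q + p) / 2)) ((2 / q : ℝ) : ℂ) =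
          (schattenNorm p X ^ (q - p) : ℝ) := by
        rw [affinePow, if_neg h0.ne', Real.rpow_def_of_pos h0, ← h1]
        push_cast; rfl
      have h5 : s.σ j ^ p = s.σ j ^ (p - 1) * s.σ j := by
        nth_rewrite 3 [← Real.rpow_one (s.σ j)]
        rw [← Real.rpow_add_of_nonneg (s.σ_nonneg j) h3.le zero_le_one, sub_add_cancel]
      rw [h4, affinePow_ofReal (s.σ_nonneg j) (by rw [h2]; exact h3.ne'), h2, h5]
      push_cast; ring
    simp_rw [h]
    rw [← ofReal_sum, ← Finset.mul_sum, ← s.schattenNorm_rpow hp, ← Real.rpow_add h0,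
      sub_add_cancel]

theorem differentiable_trace (p q : ℝ) : Differentiable ℂ fun z =>
    (t.codeform (t.dual p q z) * s.deform (s.primal p z)).trace := by
  simp_rw [trace_codeform_mul_deform]
  refine Differentiable.fun_sum fun i _ => Differentiable.fun_sum fun j _ => ?_
  exact (((differentiable_affinePow _ _ _).mul (differentiable_affinePow _ _ _)).mul
    (differentiable_affinePow _ _ _)).mul_const _

theorem exists_norm_trace_le (p q : ℝ) : ∃ K : ℝ, ∀ z : ℂ, 0 ≤ z.re → z.re ≤ 1 →
    ‖(t.codeform (t.dual p q z) * s.deform (s.primal p z)).trace‖ ≤ K := by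
  obtain ⟨K₁, h₁⟩ := exists_norm_affinePow_le (fun _ : Unit => schattenNorm p Y) q (-((q + p) / 2))
  obtain ⟨K₂, h₂⟩ := exists_norm_affinePow_le t.σ 0 (p / 2)
  obtain ⟨K₃, h₃⟩ := exists_norm_affinePow_le s.σ p (-(p / 2))
  refine ⟨(|K₁| * |K₂|) * ∑ _i : m, K₃, fun z h0 h1 =>
    (norm_trace_codeform_mul_deform_le s t (c := |K₁| * |K₂|) (fun j => ?_) _).trans ?_⟩
  · rw [dual, norm_mul]
    exact mul_le_mul ((h₁ () z h0 h1).trans (le_abs_self _))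
      ((h₂ j z h0 h1).trans (le_abs_self _)) (norm_nonneg _) (abs_nonneg _)
  · gcongr with i
    exact h₃ i z h0 h1

end SingularDecomposition

theorem sqrt_mul_sqrt_add_le {x y u v : ℝ} (hx : 0 ≤ x) (hy : 0 ≤ y) (hu : 0 ≤ u) (hv : 0 ≤ v) :
    √x * √u + √y * √v ≤ √(x + y) * √(u + v) := by
  rw [← Real.sqrt_mul (add_nonneg hx hy)]
  refine Real.le_sqrt_of_sq_le ?_
  nlinarith [sq_nonneg (√x * √v - √y * √u), Real.sq_sqrt hx, Real.sq_sqrt hy, Real.sq_sqrt hu,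
    Real.sq_sqrt hv, mul_pow (√x) (√u) 2, mul_pow (√y) (√v) 2, mul_pow (√x) (√v) 2,
    mul_pow (√y) (√u) 2]

theorem le_two_mul_rpow_of_le_interp {M N p q : ℝ} (hM : 0 ≤ M) (hN : 0 ≤ N) (hq : 0 < q)
    (hpq : 1 / p + 1 / q = 1)
    (h : M ≤ (M * N) ^ (1 - 2 / q) * (√M * √(2 * N)) ^ (2 / q)) : M ≤ 2 * N ^ (q / p) := by
  rcases hM.eq_or_lt with rfl | hM
  · positivity
  rcases hN.eq_or_lt with rfl | hN
  · rw [mul_zero, mul_zero, Real.sqrt_zero, mul_zero, Real.zero_rpow (x := 2 / q) (by positivity),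
      mul_zero] at h
    exact absurd h hM.not_ge
  have h1 := Real.log_le_log hM h
  rw [Real.log_mul (by positivity) (by positivity), Real.log_rpow (by positivity),
    Real.log_rpow (by positivity), Real.log_mul (by positivity) (by positivity),
    Real.log_mul (by positivity) (by positivity), Real.log_sqrt hM.le,
    Real.log_sqrt (by positivity), Real.log_mul two_ne_zero hN.ne'] at h1
  rw [← Real.log_le_log_iff hM (by positivity), Real.log_mul two_ne_zero (by positivity),
    Real.log_rpow hN]
  have hp : 1 / p = 1 - 1 / q := by linarith
  have hqp : q / p = q - 1 := by rw [div_eq_mul_one_div, hp]; field_simp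
  rw [hqp]
  have h2 := mul_le_mul_of_nonneg_left h1 hq.le
  have h3 : q * ((1 - 2 / q) * (Real.log M + Real.log N) +
      2 / q * (Real.log M / 2 + (Real.log 2 + Real.log N) / 2)) =
      (q - 1) * (Real.log M + Real.log N) + Real.log 2 := by
    field_simp; ring
  linarith

end

theorem mccarthy_p_le_two {m : Type*} [Fintype m] [DecidableEq m]
    (A B : Matrix m m ℂ) (p q : ℝ) (hp1 : 1 < p) (hp2 : p ≤ 2)
    (hpq : 1 / p + 1 / q = 1) :
    schattenNorm p (A + B) ^ q + schattenNorm p (A - B) ^ q ≤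
      2 * (schattenNorm p A ^ p + schattenNorm p B ^ p) ^ (q / p) := by
  obtain ⟨sA⟩ := SingularDecomposition.exists A
  obtain ⟨sB⟩ := SingularDecomposition.exists B
  obtain ⟨sS⟩ := SingularDecomposition.exists (A + B)
  obtain ⟨sD⟩ := SingularDecomposition.exists (A - B)
  have hp : 0 < p := by linarith
  have hq1 : 1 / q = 1 - 1 / p := by linarith
  have hq : 0 < q := by
    rw [← one_div_pos, hq1, sub_pos, div_lt_one hp]; exact hp1
  have hq2 : 2 / q ≤ 1 := by
    have : 1 / 2 ≤ 1 / p := one_div_le_one_div_of_le hp hp2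
    have : 2 / q = 2 * (1 / q) := by ring
    rw [this, hq1]; linarith
  have hS0 := Real.rpow_nonneg (schattenNorm_nonneg p (A + B)) q
  have hD0 := Real.rpow_nonneg (schattenNorm_nonneg p (A - B)) q
  have hA0 := Real.rpow_nonneg (schattenNorm_nonneg p A) p
  have hB0 := Real.rpow_nonneg (schattenNorm_nonneg p B) p
  let C (z : ℂ) := sS.codeform (sS.dual p q z)
  let D (z : ℂ) := sD.codeform (sD.dual p q z)
  let a (z : ℂ) := sA.deform (sA.primal p z)
  let b (z : ℂ) := sB.deform (sB.primal p z)
  let F (z : ℂ) : ℂ := (C z * a z).trace + (C z * b z).trace +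
    ((D z * a z).trace - (D z * b z).trace)
  have hF (z : ℂ) : F z = (C z * (a z + b z)).trace + (D z * (a z - b z)).trace := by
    simp only [F, Matrix.mul_add, Matrix.mul_sub, Matrix.trace_add, Matrix.trace_sub]
  have hnorm (z : ℂ) : ‖F z‖ ≤ ‖(C z * a z).trace‖ + ‖(C z * b z).trace‖ +
      (‖(D z * a z).trace‖ + ‖(D z * b z).trace‖) :=
    (norm_add_le _ _).trans (add_le_add (norm_add_le _ _) (norm_sub_le _ _))
  have hdiff : Differentiable ℂ F :=
    ((sA.differentiable_trace sS p q).add (sB.differentiable_trace sS p q)).add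
      ((sA.differentiable_trace sD p q).sub (sB.differentiable_trace sD p q))
  have hbdd : BddAbove ((norm ∘ F) '' Complex.HadamardThreeLines.verticalClosedStrip 0 1) := by
    obtain ⟨K₁, h₁⟩ := sA.exists_norm_trace_le sS p q
    obtain ⟨K₂, h₂⟩ := sB.exists_norm_trace_le sS p q
    obtain ⟨K₃, h₃⟩ := sA.exists_norm_trace_le sD p q
    obtain ⟨K₄, h₄⟩ := sB.exists_norm_trace_le sD p q
    refine ⟨K₁ + K₂ + (K₃ + K₄), ?_⟩
    rintro _ ⟨z, ⟨h0, h1⟩, rfl⟩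
    exact (hnorm z).trans (add_le_add (add_le_add (h₁ z h0 h1) (h₂ z h0 h1))
      (add_le_add (h₃ z h0 h1) (h₄ z h0 h1)))
  have hleft : ∀ z ∈ Complex.re ⁻¹' {0}, ‖F z‖ ≤
      (schattenNorm p (A + B) ^ q + schattenNorm p (A - B) ^ q) *
        (schattenNorm p A ^ p + schattenNorm p B ^ p) := by
    intro z hz
    have hSA := sA.norm_trace_codeform_mul_deform_le sS (sS.norm_dual_le (p := p) (q := q) hz)
      (sA.primal p z)
    have hSB := sB.norm_trace_codeform_mul_deform_le sS (sS.norm_dual_le (p := p) (q := q) hz)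
      (sB.primal p z)
    have hDA := sA.norm_trace_codeform_mul_deform_le sD (sD.norm_dual_le (p := p) (q := q) hz)
      (sA.primal p z)
    have hDB := sB.norm_trace_codeform_mul_deform_le sD (sD.norm_dual_le (p := p) (q := q) hz)
      (sB.primal p z)
    rw [sA.sum_norm_primal hp hz] at hSA hDA
    rw [sB.sum_norm_primal hp hz] at hSB hDB
    have := hnorm z
    simp only [C, D, a, b] at this
    linarith
  have hright : ∀ z ∈ Complex.re ⁻¹' {1}, ‖F z‖ ≤
      √(schattenNorm p (A + B) ^ q + schattenNorm p (A - B) ^ q) *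
        √(2 * (schattenNorm p A ^ p + schattenNorm p B ^ p)) := by
    intro z hz
    have hC := (sS.frobSq_codeform_le (sS.dual p q z)).trans (sS.sum_sq_norm_dual_le hp hz)
    have hD := (sD.frobSq_codeform_le (sD.dual p q z)).trans (sD.sum_sq_norm_dual_le hp hz)
    have ha := (sA.frobSq_deform_le (sA.primal p z)).trans_eq (sA.sum_sq_norm_primal hp hz)
    have hb := (sB.frobSq_deform_le (sB.primal p z)).trans_eq (sB.sum_sq_norm_primal hp hz)
    calc ‖F z‖ ≤ ‖(C z * (a z + b z)).trace‖ + ‖(D z * (a z - b z)).trace‖ := by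
          rw [hF]; exact norm_add_le _ _
      _ ≤ √(frobSq (C z)) * √(frobSq (a z + b z)) + √(frobSq (D z)) * √(frobSq (a z - b z)) :=
          add_le_add (norm_trace_mul_le _ _) (norm_trace_mul_le _ _)
      _ ≤ √(frobSq (C z) + frobSq (D z)) * √(frobSq (a z + b z) + frobSq (a z - b z)) :=
          sqrt_mul_sqrt_add_le (frobSq_nonneg _) (frobSq_nonneg _) (frobSq_nonneg _)
            (frobSq_nonneg _)
      _ ≤ _ := by
          rw [frobSq_add_add_frobSq_sub]
          exact mul_le_mul (Real.sqrt_le_sqrt (add_le_add hC hD)) (Real.sqrt_le_sqrt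
            (mul_le_mul_of_nonneg_left (add_le_add ha hb) zero_le_two)) (Real.sqrt_nonneg _)
            (Real.sqrt_nonneg _)
  have hinterp := Complex.HadamardThreeLines.norm_le_interp_of_mem_verticalClosedStrip'
    (z := ((2 / q : ℝ) : ℂ)) zero_lt_one ⟨by rw [Complex.ofReal_re]; positivity, hq2⟩
    hdiff.diffContOnCl hbdd hleft hright
  have hval : F ((2 / q : ℝ) : ℂ) =
      ((schattenNorm p (A + B) ^ q + schattenNorm p (A - B) ^ q : ℝ) : ℂ) := by
    rw [hF]
    simp only [C, D, a, b]
    rw [sA.deform_primal hp hpq, sB.deform_primal hp hpq, sS.trace_codeform_dual hp hq hpq,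
      sD.trace_codeform_dual hp hq hpq, ← Complex.ofReal_add]
  rw [hval, Complex.norm_real, Real.norm_of_nonneg (add_nonneg hS0 hD0), Complex.ofReal_re,
    sub_zero, sub_zero, div_one] at hinterp
  exact le_two_mul_rpow_of_le_interp (add_nonneg hS0 hD0) (add_nonneg hA0 hB0) hq hpq hinterp
end
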